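/- Let n, a, b be natural numbers with n > b > a ≥ 0 and n ≥ a + b + 2. Let d = gcd(n−a, b−a) and suppose ((n−a)/d) + ((b−a)/d) ≡ 0 (mod 3) and ((b−a)/d) ≡ 0 (mod 2) (so that X^{n−a} − X^{b−a} − 1 is reducible over ℚ). Let ρ be a positive real number satisfying ρ^n − ρ^b − ρ^a = 0. Then (X^{2d} − X^d + 1) · (minimal polynomial of ρ over ℚ) = X^{n−a} − X^{b−a} − 1. -/

import Mathlib

open Polynomial

theorem utri_mirror_cases {p q : ℤ[X]} (hp : p.IsUnitTrinomial)
    (hpq : p * p.mirror = q * q.mirror) : q = p ∨ q = -p ∨ q = p.mirror ∨ q = -p.mirror := by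
  have hq : IsUnitTrinomial q := (isUnitTrinomial_iff'' hpq).mp hp
  obtain ⟨k, m, n, hkm, hmn, u, v, w, hp⟩ := hp
  obtain ⟨k', m', n', hkm', hmn', x, y, z, hq⟩ := hq
  have hk : k = k' := by
    rw [← mul_right_inj' (show 2 ≠ 0 from two_ne_zero), ←
      trinomial_natTrailingDegree hkm hmn u.ne_zero, ← hp, ← natTrailingDegree_mul_mirror, hpq,
      natTrailingDegree_mul_mirror, hq, trinomial_natTrailingDegree hkm' hmn' x.ne_zero]
  have hn : n = n' := by
    rw [← mul_right_inj' (show 2 ≠ 0 from two_ne_zero), ← trinomial_natDegree hkm hmn w.ne_zero, ←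
      hp, ← natDegree_mul_mirror, hpq, natDegree_mul_mirror, hq,
      trinomial_natDegree hkm' hmn' z.ne_zero]
  subst hk
  subst hn
  rcases eq_or_eq_neg_of_sq_eq_sq (y : ℤ) (v : ℤ)
      ((Int.isUnit_sq y.isUnit).trans (Int.isUnit_sq v.isUnit).symm) with
    (h1 | h1)
  · rw [h1] at hq
    rcases IsUnitTrinomial.irreducible_aux3 hkm hmn hkm' hmn' u v w x z hp hq hpq with (h2 | h2)
    · exact Or.inl h2
    · exact Or.inr (Or.inr (Or.inl h2))
  · rw [h1] at hq
    rw [trinomial_def] at hp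
    rw [← neg_inj, neg_add, neg_add, ← neg_mul, ← neg_mul, ← neg_mul, ← C_neg, ← C_neg, ← C_neg]
      at hp
    rw [← neg_mul_neg, ← mirror_neg] at hpq
    rcases IsUnitTrinomial.irreducible_aux3 hkm hmn hkm' hmn' (-u) (-v) (-w) x z hp hq hpq with (rfl | rfl)
    · exact Or.inr (Or.inl rfl)
    · exact Or.inr (Or.inr (Or.inr p.mirror_neg))

theorem trin_dvd {R : Type*} [CommRing R] (y : R) (k m : ℕ) (hc : Nat.Coprime k m)
    (h3 : (k + m) % 3 = 0) (h2 : m % 2 = 0) : y ^ 2 - y + 1 ∣ y ^ k - y ^ m - 1 := by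
  have h6 : ∀ i : ℕ, y ^ 2 - y + 1 ∣ y ^ (6 * i) - 1 := by
    intro i
    have h1 : y ^ 6 - 1 ∣ y ^ (6 * i) - 1 := by
      rw [pow_mul]; simpa using sub_dvd_pow_sub_pow (y ^ 6) 1 i
    refine dvd_trans ⟨(y + 1) * (y ^ 3 - 1), by ring⟩ h1
  have hk2 : k % 2 = 1 := by
    by_contra hk
    have := Nat.dvd_gcd (Nat.dvd_of_mod_eq_zero (show k % 2 = 0 by omega)) (Nat.dvd_of_mod_eq_zero h2)
    rw [hc] at this; omega
  have hm3 : m % 3 ≠ 0 := by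
    intro hm
    have := Nat.dvd_gcd (Nat.dvd_of_mod_eq_zero (show k % 3 = 0 by omega)) (Nat.dvd_of_mod_eq_zero hm)
    rw [hc] at this; omega
  have hcase : (k % 6 = 1 ∧ m % 6 = 2) ∨ (k % 6 = 5 ∧ m % 6 = 4) := by
    have hk6 : k % 6 = 1 ∨ k % 6 = 3 ∨ k % 6 = 5 := by omega
    have hm6 : m % 6 = 2 ∨ m % 6 = 4 := by omega
    rcases hk6 with h | h | h <;> rcases hm6 with h' | h' <;> omega
  obtain ⟨s, hs⟩ := h6 (k / 6)
  obtain ⟨t, ht⟩ := h6 (m / 6)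
  rw [← Nat.div_add_mod k 6, ← Nat.div_add_mod m 6, pow_add, pow_add]
  generalize y ^ (6 * (k / 6)) = U at *
  generalize y ^ (6 * (m / 6)) = V at *
  rcases hcase with ⟨e1, e2⟩ | ⟨e1, e2⟩ <;> simp only [e1, e2] 
  · exact ⟨y * s - y ^ 2 * t - 1, by linear_combination y * hs - y ^ 2 * ht⟩
  · exact ⟨y ^ 5 * s - y ^ 4 * t + (y ^ 3 - y - 1),
      by linear_combination y ^ 5 * hs - y ^ 4 * ht⟩

/-- common roots of trinomial and mirror -/
theorem common_root (y : ℂ) (k m : ℕ) (hc : Nat.Coprime k m)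
    (h3 : (k + m) % 3 = 0) (h2 : m % 2 = 0) (A B : ℂ) (hA : y ^ k = A) (hB : y ^ m = B)
    (h1 : A = B + 1) (hBB : B ^ 2 + B + 1 = 0) : y ^ 2 - y + 1 = 0 := by
  have hB3 : B ^ 3 = 1 := by linear_combination (B - 1) * hBB
  have hk2 : k % 2 = 1 := by
    by_contra hk
    have := Nat.dvd_gcd (Nat.dvd_of_mod_eq_zero (show k % 2 = 0 by omega)) (Nat.dvd_of_mod_eq_zero h2)
    rw [hc] at this; omega
  have hA3 : A ^ 3 = -1 := by rw [h1]; linear_combination (B + 2) * hBB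
  have hy6 : y ^ 6 = 1 := by
    have hk : (y ^ 6) ^ k = 1 := by
      rw [← pow_mul, mul_comm, pow_mul, hA]; linear_combination (A ^ 3 - 1) * hA3
    have hm : (y ^ 6) ^ m = 1 := by
      rw [← pow_mul, mul_comm, pow_mul, hB]; linear_combination (B ^ 3 + 1) * hB3
    have := pow_gcd_eq_one.mpr ⟨hk, hm⟩
    rwa [hc, pow_one] at this
  have hy3 : y ^ 3 = -1 := by
    have e : y ^ (k + m) = -1 := by
      rw [pow_add, hA, hB, h1]; linear_combination hBB
    rw [show k + m = 6 * ((k + m) / 6) + 3 by omega, pow_add, pow_mul, hy6, one_pow, one_mul] at e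
    exact e
  have hy : y + 1 ≠ 0 := by
    intro h0
    have : y = -1 := by linear_combination h0
    rw [this, Even.neg_one_pow (Nat.even_iff.mpr h2)] at hB
    rw [← hB] at hBB; norm_num at hBB
  have : (y + 1) * (y ^ 2 - y + 1) = 0 := by linear_combination hy3
  exact (mul_eq_zero.mp this).resolve_left hy

theorem cofactor_irred (k m d : ℕ) (hd0 : 0 < d) (hm0 : 0 < m) (hmk : m < k)
    (hc : Nat.Coprime k m) (h3 : (k + m) % 3 = 0) (h2 : m % 2 = 0) (g : ℤ[X])
    (hg : (X ^ (d * k) - X ^ (d * m) - 1 : ℤ[X]) = (X ^ (2 * d) - X ^ d + 1) * g)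
    (hgm : g.Monic) (hgu : ¬ IsUnit g) : Irreducible g := by
  have hdm : 0 < d * m := by positivity
  have hdk : d * m < d * k := by gcongr
  set p : ℤ[X] := X ^ (d * k) - X ^ (d * m) - 1 with hpdef
  have hp : p = trinomial 0 (d * m) (d * k) ((-1 : ℤˣ) : ℤ) ((-1 : ℤˣ) : ℤ) ((1 : ℤˣ) : ℤ) := by
    simp [trinomial, hpdef]; ring
  have hpu : p.IsUnitTrinomial := ⟨_, _, _, hdm, hdk, _, _, _, hp⟩
  have hpm : p.mirror = -X ^ (d * k) - X ^ (d * k - d * m) + 1 := by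
    rw [hp, trinomial_mirror hdm hdk (by simp) (by simp)]
    simp [trinomial]; ring
  set H : ℤ[X] := X ^ (2 * d) - X ^ d + 1 with hH
  have hHt : H = trinomial 0 d (2 * d) 1 (-1) 1 := by
    simp [trinomial, hH]; ring
  have hHm : H.mirror = H := by
    rw [hHt, trinomial_mirror hd0 (by omega) (by simp) (by simp)]
    congr 1; omega
  have hH0 : H ≠ 0 := by
    rw [hHt]; exact (trinomial_monic hd0 (by omega)).ne_zero
  refine irreducible_of_mirror hgu (fun q hq => ?_) ?_
  · have key : p * p.mirror = (H * q) * (H * q).mirror := by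
      rw [hg, mirror_mul_of_domain, mirror_mul_of_domain, hHm]
      linear_combination H ^ 2 * hq
    have hpm' : p.mirror = H * g.mirror := by rw [hg, mirror_mul_of_domain, hHm]
    rcases utri_mirror_cases hpu key with h | h | h | h
    · left; exact mul_left_cancel₀ hH0 (h.trans hg)
    · right; left; exact mul_left_cancel₀ hH0 (by rw [h, hg]; ring)
    · right; right; left; exact mul_left_cancel₀ hH0 (h.trans hpm')
    · right; right; right; exact mul_left_cancel₀ hH0 (by rw [h, hpm']; ring)
  · intro c hc1 hc2
    obtain ⟨e, he⟩ := hc1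
    have hlc : IsUnit c.leadingCoeff := by
      have := congrArg leadingCoeff he
      rw [hgm.leadingCoeff, leadingCoeff_mul] at this
      exact IsUnit.of_mul_eq_one _ this.symm
    by_contra hcu
    have hdeg : c.degree ≠ 0 := by
      intro h0
      apply hcu
      have := eq_C_of_degree_eq_zero h0
      rw [this, isUnit_C]
      rw [this, leadingCoeff_C] at hlc
      exact hlc
    have hinj : Function.Injective (algebraMap ℤ ℂ) := (algebraMap ℤ ℂ).injective_int
    obtain ⟨z, hz⟩ := Complex.exists_root (f := c.map (algebraMap ℤ ℂ)) (by
      rw [degree_map_eq_of_injective hinj]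
      refine lt_of_le_of_ne (zero_le_degree_iff.mpr ?_) hdeg.symm
      rintro rfl; simp at hlc)
    have hzc : aeval z c = 0 := by rwa [IsRoot, eval_map_algebraMap] at hz
    have hzg : aeval z g = 0 := by rw [he, map_mul, hzc, zero_mul]
    have hzgm : aeval z g.mirror = 0 := by
      obtain ⟨e', he'⟩ := hc2
      rw [he', map_mul, hzc, zero_mul]
    have hzp : aeval z p = 0 := by rw [hg, map_mul, hzg, mul_zero]
    have hzpm : aeval z p.mirror = 0 := by
      rw [hg, mirror_mul_of_domain, map_mul, hzgm, mul_zero]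
    rw [hpm] at hzpm
    simp only [hpdef, map_sub, map_add, map_neg, map_pow, aeval_X, map_one] at hzp hzpm
    have hsub : z ^ (d * k - d * m) * z ^ (d * m) = z ^ (d * k) := by
      rw [← pow_add]; congr 1; omega
    have hBB : (z ^ (d * m)) ^ 2 + z ^ (d * m) + 1 = 0 := by
      have hA : z ^ (d * k) = z ^ (d * m) + 1 := by linear_combination hzp
      rw [hA] at hsub hzpm
      linear_combination (-z ^ (d * m)) * hzpm - hsub
    have hy := common_root (z ^ d) k m hc h3 h2 (z ^ (d * k)) (z ^ (d * m)) (pow_mul _ _ _).symm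
      (pow_mul _ _ _).symm (by linear_combination hzp) hBB
    have hzH : aeval z H = 0 := by
      simp only [hH, map_sub, map_add, map_pow, aeval_X, map_one]
      rw [mul_comm 2 d, pow_mul]; exact hy
    have hder : aeval z (derivative p) = 0 := by
      rw [hg, derivative_mul, map_add, map_mul, map_mul, hzg, hzH]; ring
    have hder2 : ((d * k : ℕ) : ℂ) * z ^ (d * k - 1) - ((d * m : ℕ) : ℂ) * z ^ (d * m - 1) = 0 := by
      rw [← hder]; simp [hpdef, derivative_X_pow]
    have e1 : z ^ (d * k - 1) * z = z ^ (d * k) := by rw [← pow_succ]; congr 1; omega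
    have e2 : z ^ (d * m - 1) * z = z ^ (d * m) := by rw [← pow_succ]; congr 1; omega
    have hkm : ((d * k : ℕ) : ℂ) * z ^ (d * k) = ((d * m : ℕ) : ℂ) * z ^ (d * m) := by
      rw [← e1, ← e2]; linear_combination z * hder2
    have hA3 : (z ^ (d * k)) ^ 3 = -1 := by
      rw [show z ^ (d * k) = z ^ (d * m) + 1 by linear_combination hzp]
      linear_combination (z ^ (d * m) + 2) * hBB
    have hB3 : (z ^ (d * m)) ^ 3 = 1 := by linear_combination (z ^ (d * m) - 1) * hBB
    have hnA : ‖z ^ (d * k)‖ = 1 := by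
      have := congrArg norm hA3
      rw [norm_pow, norm_neg, norm_one] at this
      exact (pow_eq_one_iff_of_nonneg (norm_nonneg _) three_ne_zero).mp this
    have hnB : ‖z ^ (d * m)‖ = 1 := by
      have := congrArg norm hB3
      rw [norm_pow, norm_one] at this
      exact (pow_eq_one_iff_of_nonneg (norm_nonneg _) three_ne_zero).mp this
    have := congrArg norm hkm
    rw [norm_mul, norm_mul, hnA, hnB, mul_one, mul_one, Complex.norm_natCast,
      Complex.norm_natCast] at this
    have : d * k = d * m := by exact_mod_cast this
    omega

/-- In the reducible case of Ljunggren's theorem, the minimal polynomial of the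
positive root ρ of x^n − x^b − x^a is the cofactor:
(X^{2d} − X^d + 1) · Irr(ρ) = X^{n−a} − X^{b−a} − 1. -/
theorem minpoly_of_reducible_trinomial (n a b d : ℕ)
    (hab : a < b) (hbn : b < n) (hn : a + b + 2 ≤ n)
    (hd : d = Nat.gcd (n - a) (b - a))
    (h3 : ((n - a) / d + (b - a) / d) % 3 = 0) (h2 : ((b - a) / d) % 2 = 0)
    (ρ : ℝ) (hρ : 0 < ρ) (h : ρ ^ n - ρ ^ b - ρ ^ a = 0) :
    ((X : Polynomial ℚ) ^ (2 * d) - X ^ d + 1) * minpoly ℚ ρ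
      = (X : Polynomial ℚ) ^ (n - a) - X ^ (b - a) - 1 := by
  obtain ⟨k, m, hc, hk, hm, hd0⟩ : ∃ k m : ℕ, Nat.Coprime k m ∧ n - a = d * k ∧ b - a = d * m
      ∧ 0 < d := by
    have hpos : 0 < Nat.gcd (n - a) (b - a) := Nat.gcd_pos_of_pos_left _ (by omega)
    refine ⟨(n - a) / d, (b - a) / d, ?_, ?_, ?_, hd ▸ hpos⟩
    · rw [hd]; exact Nat.coprime_div_gcd_div_gcd hpos
    · rw [hd]; exact (Nat.mul_div_cancel' (Nat.gcd_dvd_left _ _)).symm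
    · rw [hd]; exact (Nat.mul_div_cancel' (Nat.gcd_dvd_right _ _)).symm
  rw [hk, hm, Nat.mul_div_cancel_left _ hd0, Nat.mul_div_cancel_left _ hd0] at h3
  rw [hm, Nat.mul_div_cancel_left _ hd0] at h2
  have hm0 : 0 < m := by
    rcases Nat.eq_zero_or_pos m with h0 | h0
    · rw [h0] at hm; omega
    · exact h0
  have hdmk : d * m < d * k := by omega
  have hmk : m < k := lt_of_mul_lt_mul_left hdmk (Nat.zero_le d)
  rw [hk, hm]
  have hroot : ρ ^ (d * k) - ρ ^ (d * m) - 1 = 0 := by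
    have ea : ρ ^ a ≠ 0 := by positivity
    have e1 : ρ ^ n = ρ ^ a * ρ ^ (d * k) := by rw [← pow_add]; congr 1; omega
    have e2 : ρ ^ b = ρ ^ a * ρ ^ (d * m) := by rw [← pow_add]; congr 1; omega
    rw [e1, e2] at h
    exact (mul_eq_zero.mp (show ρ ^ a * (ρ ^ (d * k) - ρ ^ (d * m) - 1) = 0 by
      linear_combination h)).resolve_left ea
  obtain ⟨g, hg⟩ := trin_dvd (X ^ d : ℤ[X]) k m hc h3 h2
  have hg' : (X ^ (d * k) - X ^ (d * m) - 1 : ℤ[X]) = (X ^ (2 * d) - X ^ d + 1) * g := by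
    rw [pow_mul, pow_mul, hg, mul_comm 2 d, pow_mul]
  have hHm : (X ^ (2 * d) - X ^ d + 1 : ℤ[X]).Monic := by
    have : (X ^ (2 * d) - X ^ d + 1 : ℤ[X]) = trinomial 0 d (2 * d) 1 (-1) 1 := by
      simp [trinomial]; ring
    rw [this]; exact trinomial_monic hd0 (by omega)
  have hpm : (X ^ (d * k) - X ^ (d * m) - 1 : ℤ[X]).Monic := by
    have : (X ^ (d * k) - X ^ (d * m) - 1 : ℤ[X]) = trinomial 0 (d * m) (d * k) (-1) (-1) 1 := by
      simp [trinomial]; ring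
    rw [this]; exact trinomial_monic (by positivity) hdmk
  have hgm : g.Monic := hHm.of_mul_monic_left (hg' ▸ hpm)
  have hgρ : aeval ρ g = 0 := by
    have h0 := congrArg (aeval ρ) hg'
    simp only [map_mul, map_sub, map_add, map_pow, aeval_X, map_one] at h0
    rw [hroot] at h0
    refine (mul_eq_zero.mp h0.symm).resolve_left ?_
    rw [mul_comm 2 d, pow_mul]
    nlinarith [sq_nonneg (ρ ^ d - 1 / 2)]
  have hgu : ¬ IsUnit g := by
    intro hu
    have := hgm.eq_one_of_isUnit hu
    rw [this] at hgρ; simp at hgρ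
  have hirr := cofactor_irred k m d hd0 hm0 hmk hc h3 h2 g hg' hgm hgu
  have hirrQ := (IsPrimitive.Int.irreducible_iff_irreducible_map_cast hgm.isPrimitive).mp hirr
  have hmin : minpoly ℚ ρ = g.map (Int.castRingHom ℚ) := by
    refine (minpoly.eq_of_irreducible_of_monic hirrQ ?_ (hgm.map _)).symm
    have := aeval_map_algebraMap ℚ ρ g
    rw [hgρ] at this
    exact this
  rw [hmin]
  have := congrArg (Polynomial.map (Int.castRingHom ℚ)) hg'
  simpa using this.symm
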